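/- arXiv:1912.03377 — 3 statements merged into one kernel-verified Lean document; each statement's English description precedes it below -/
import Mathlib

section
/- Let S be a semigroup admitting a right-invariant mean. Then S satisfies the left ideal intersection property: for every P, Q ∈ S the principal left ideals intersect, i.e. there exist a, b ∈ S with a·P = b·Q. -/
noncomputable section

/-- A function `S → ℝ` is bounded, i.e. belongs to `ℓ∞(S)`. -/
def Bddf {S : Type*} (φ : S → ℝ) : Prop := ∃ C : ℝ, ∀ x, |φ x| ≤ C

/-- A mean on a semigroup `S`: a positive linear functional on `ℓ∞(S)` with
`M(1) = 1`.  (Its values on unbounded functions are irrelevant.) -/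
structure Mean (S : Type*) [Mul S] where
  toFun : (S → ℝ) → ℝ
  map_add : ∀ φ ψ : S → ℝ, Bddf φ → Bddf ψ → toFun (φ + ψ) = toFun φ + toFun ψ
  map_smul : ∀ (c : ℝ) (φ : S → ℝ), Bddf φ → toFun (c • φ) = c * toFun φ
  nonneg : ∀ φ : S → ℝ, Bddf φ → (∀ x, 0 ≤ φ x) → 0 ≤ toFun φ
  norm_one : toFun (fun _ => 1) = 1

/-- A mean is right-invariant if `M(x ↦ φ(x·s)) = M(φ)` for all `s`. -/
def Mean.RightInvariant {S : Type*} [Mul S] (M : Mean S) : Prop :=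
  ∀ (s : S) (φ : S → ℝ), Bddf φ → M.toFun (fun x => φ (x * s)) = M.toFun φ

/-- A mean is left-invariant if `M(x ↦ φ(s·x)) = M(φ)` for all `s`. -/
def Mean.LeftInvariant {S : Type*} [Mul S] (M : Mean S) : Prop :=
  ∀ (s : S) (φ : S → ℝ), Bddf φ → M.toFun (fun x => φ (s * x)) = M.toFun φ

theorem Bddf.const {S : Type*} (c : ℝ) : Bddf (fun _ : S => c) := ⟨|c|, fun _ => le_rfl⟩

theorem Bddf.add {S : Type*} {φ ψ : S → ℝ} (hφ : Bddf φ) (hψ : Bddf ψ) : Bddf (φ + ψ) := by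
  obtain ⟨C, hC⟩ := hφ
  obtain ⟨D, hD⟩ := hψ
  exact ⟨C + D, fun x => (abs_add_le _ _).trans (add_le_add (hC x) (hD x))⟩

theorem Bddf.smul {S : Type*} (c : ℝ) {φ : S → ℝ} (hφ : Bddf φ) : Bddf (c • φ) := by
  obtain ⟨C, hC⟩ := hφ
  refine ⟨|c| * C, fun x => ?_⟩
  rw [Pi.smul_apply, smul_eq_mul, abs_mul]
  exact mul_le_mul_of_nonneg_left (hC x) (abs_nonneg c)

theorem Bddf.indicator_one {S : Type*} (A : Set S) : Bddf (A.indicator (fun _ => (1 : ℝ))) := by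
  refine ⟨1, fun x => ?_⟩
  by_cases hx : x ∈ A <;> simp [hx]

/-- A right-invariant mean gives full mass to every principal left ideal. -/
theorem Mean.RightInvariant.indicator_leftIdeal {S : Type*} [Mul S] {M : Mean S}
    (hM : M.RightInvariant) (P : S) :
    M.toFun ((Set.range (· * P)).indicator (fun _ => (1 : ℝ))) = 1 := by
  refine (hM P _ (Bddf.indicator_one _)).symm.trans (Eq.trans ?_ M.norm_one)
  congr 1
  funext x
  exact Set.indicator_of_mem (Set.mem_range_self (f := (· * P)) x) (fun _ => (1 : ℝ))

/-- Two sets to which a mean gives full mass intersect. -/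
theorem Mean.inter_nonempty {S : Type*} [Mul S] (M : Mean S) {A B : Set S}
    (hA : M.toFun (A.indicator (fun _ => (1 : ℝ))) = 1)
    (hB : M.toFun (B.indicator (fun _ => (1 : ℝ))) = 1) : (A ∩ B).Nonempty := by
  by_contra hAB
  have hsum := (Bddf.indicator_one A).add (Bddf.indicator_one B)
  have key := M.nonneg _ ((Bddf.const 1).add (hsum.smul (-1))) fun x => by
    have hx : ¬(x ∈ A ∧ x ∈ B) := fun h => hAB ⟨x, h⟩
    by_cases hxA : x ∈ A <;> by_cases hxB : x ∈ B <;> simp_all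
  rw [M.map_add _ _ (Bddf.const 1) (hsum.smul (-1)), M.map_smul _ _ hsum,
    M.map_add _ _ (Bddf.indicator_one A) (Bddf.indicator_one B), M.norm_one, hA, hB] at key
  norm_num at key

/-- A semigroup admitting a right-invariant mean satisfies the left ideal
intersection property: any two principal left ideals intersect. -/
theorem right_amenable_left_ideal_intersection {S : Type*} [Semigroup S]
    (hM : ∃ M : Mean S, M.RightInvariant) :
    ∀ P Q : S, ∃ a b : S, a * P = b * Q := by
  obtain ⟨M, hM⟩ := hM
  intro P Q
  obtain ⟨_, ⟨a, rfl⟩, ⟨b, hb⟩⟩ :=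
    M.inter_nonempty (hM.indicator_leftIdeal P) (hM.indicator_leftIdeal Q)
  exact ⟨a, b, hb.symm⟩
end
end

section
/- Let S be a right-cancellative semigroup admitting a right-invariant mean, and define a relation on S by a ≈ b if and only if there exists x ∈ S with x·a = x·b. Then ≈ is an equivalence relation compatible with the multiplication on both sides (a ≈ b implies a·c ≈ b·c and c·a ≈ c·b for all c ∈ S), the quotient semigroup S/≈ is cancellative, and S/≈ is embeddable into a group, i.e. there exist a group G and an injective semigroup homomorphism S/≈ → G. -/
noncomputable section

lemma Mean.toFun_add_le_one {S : Type*} [Mul S] (M : Mean S) {φ ψ : S → ℝ}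
    (hφ : Bddf φ) (hψ : Bddf ψ) (h : ∀ x, φ x + ψ x ≤ 1) :
    M.toFun φ + M.toFun ψ ≤ 1 := by
  have bdd_add : ∀ {f g : S → ℝ}, Bddf f → Bddf g → Bddf (f + g) := by
    rintro f g ⟨C, hC⟩ ⟨D, hD⟩
    exact ⟨C + D, fun x => (abs_add_le _ _).trans (add_le_add (hC x) (hD x))⟩
  have bdd_neg : Bddf ((-1 : ℝ) • (φ + ψ)) := by
    obtain ⟨C, hC⟩ := bdd_add hφ hψ
    exact ⟨C, fun x => by
      rw [Pi.smul_apply, smul_eq_mul, neg_one_mul, abs_neg]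
      exact hC x⟩
  have bdd_one : Bddf (fun _ : S => (1 : ℝ)) := ⟨1, by simp⟩
  have key := M.nonneg _ (bdd_add bdd_one bdd_neg) fun x => by
    have := h x
    simp only [Pi.add_apply, Pi.smul_apply, smul_eq_mul]
    linarith
  rw [M.map_add _ _ bdd_one bdd_neg, M.map_smul _ _ (bdd_add hφ hψ), M.map_add _ _ hφ hψ,
    M.norm_one] at key
  linarith

/-- A right-invariant mean gives full mass to every principal left ideal, so any two of these
meet. -/
lemma Mean.RightInvariant.exists_mul_eq_mul {S : Type*} [Mul S] {M : Mean S}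
    (hM : M.RightInvariant) (a b : S) : ∃ x y : S, x * a = y * b := by
  by_contra! hab
  have bdd_ind : ∀ A : Set S, Bddf (A.indicator fun _ => (1 : ℝ)) := fun A =>
    ⟨1, fun x => by by_cases hx : x ∈ A <;> simp [hx]⟩
  have mass : ∀ s : S, M.toFun ((Set.range (· * s)).indicator fun _ => (1 : ℝ)) = 1 := by
    intro s
    refine (hM s _ (bdd_ind _)).symm.trans (Eq.trans (congrArg M.toFun ?_) M.norm_one)
    ext x
    simp
  have key := M.toFun_add_le_one (bdd_ind (Set.range (· * a))) (bdd_ind (Set.range (· * b)))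
    fun x => by
      by_cases ha : x ∈ Set.range (· * a) <;> by_cases hb : x ∈ Set.range (· * b)
      · obtain ⟨y, rfl⟩ := ha
        obtain ⟨z, hz⟩ := hb
        exact absurd hz.symm (hab y z)
      all_goals simp only [Set.indicator, ha, hb, if_true, if_false]; norm_num
  rw [mass, mass] at key
  norm_num at key

section OreLocalization

open OreLocalization

variable {S : Type*} [Semigroup S]

lemma WithOne.exists_mul_eq_mul (h : ∀ a b : S, ∃ x y : S, x * a = y * b) (r s : WithOne S) :
    ∃ x y : WithOne S, x * r = y * s := by
  induction r with
  | one => exact ⟨s, 1, by simp⟩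
  | coe a =>
    induction s with
    | one => exact ⟨1, a, by simp⟩
    | coe b =>
      obtain ⟨x, y, hxy⟩ := h a b
      exact ⟨x, y, by exact_mod_cast hxy⟩

lemma WithOne.exists_mul_eq_of_mul_eq (hrc : ∀ a x y : S, x * a = y * a → x = y)
    {r₁ r₂ s : WithOne S} (h : r₁ * s = r₂ * s) : ∃ t : WithOne S, t * r₁ = t * r₂ := by
  have aux : ∀ a b : S, b * a = a → a * b = a := fun a b hab =>
    hrc a _ _ (by rw [mul_assoc, hab])
  induction s with
  | one => exact ⟨1, by simpa using h⟩
  | coe a =>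
    refine ⟨a, ?_⟩
    induction r₁ with
    | one =>
      induction r₂ with
      | one => rfl
      | coe b =>
        rw [one_mul, ← coe_mul, coe_inj] at h
        rw [mul_one, ← coe_mul, aux a b h.symm]
    | coe b =>
      induction r₂ with
      | one =>
        rw [one_mul, ← coe_mul, coe_inj] at h
        rw [mul_one, ← coe_mul, aux a b h]
      | coe c =>
        rw [← coe_mul, ← coe_mul, coe_inj] at h
        rw [hrc a b c h]

/-- A right-cancellative semigroup with common left multiples, once a unit is adjoined, satisfies
the Ore condition with respect to all of its elements. -/
@[reducible]
def WithOne.oreSetTop (hrc : ∀ a x y : S, x * a = y * a → x = y)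
    (h : ∀ a b : S, ∃ x y : S, x * a = y * b) : OreSet (⊤ : Submonoid (WithOne S)) where
  ore_right_cancel _ _ _ hs :=
    (exists_mul_eq_of_mul_eq hrc hs).imp' (fun t => ⟨t, trivial⟩) fun _ => id
  oreNum r s := (exists_mul_eq_mul h r s).choose_spec.choose
  oreDenom r s := ⟨(exists_mul_eq_mul h r s).choose, trivial⟩
  ore_eq r s := (exists_mul_eq_mul h r s).choose_spec.choose_spec

/-- A right-cancellative semigroup with common left multiples maps to a group of left fractions,
identifying exactly the elements that agree after some left multiplication. -/
lemma exists_mulHom_group_eq_iff {S : Type u} [Semigroup S]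
    (hrc : ∀ a x y : S, x * a = y * a → x = y)
    (h : ∀ a b : S, ∃ x y : S, x * a = y * b) :
    ∃ (G : Type u) (_ : Group G) (f : S →ₙ* G), ∀ a b, f a = f b ↔ ∃ x, x * a = x * b := by
  let _ := WithOne.oreSetTop hrc h
  refine ⟨(OreLocalization (⊤ : Submonoid (WithOne S)) (WithOne S))ˣ, inferInstance,
    { toFun := fun a => numeratorUnit ⟨a, trivial⟩
      map_mul' := fun a b => Units.ext <|
        (numeratorHom (S := (⊤ : Submonoid (WithOne S)))).map_mul a b }, fun a b => ?_⟩
  refine Units.ext_iff.trans (oreDiv_eq_iff.trans ⟨?_, ?_⟩)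
  · rintro ⟨⟨u, _⟩, v, huv, hu⟩
    replace hu : u = v := by simpa using hu
    replace huv : u * b = u * a := by simpa [hu, Submonoid.smul_def] using huv
    induction u with
    | one => exact ⟨a, by rw [WithOne.coe_inj.1 (by simpa using huv : (b : WithOne S) = a)]⟩
    | coe x => exact ⟨x, by exact_mod_cast huv.symm⟩
  · rintro ⟨x, hx⟩
    refine ⟨⟨x, trivial⟩, x, ?_, by simp⟩
    change (x : WithOne S) * b = x * a
    exact_mod_cast hx.symm

end OreLocalization

/-- For a right-cancellative semigroup admitting a right-invariant mean, the
relation `a ≈ b ↔ ∃ x, x·a = x·b` is a congruence (an equivalence relation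
compatible with multiplication on both sides), the quotient semigroup is
cancellative, and the quotient embeds into a group. -/
theorem quotient_embeds_into_group {S : Type u} [Semigroup S]
    (hrc : ∀ a x y : S, x * a = y * a → x = y)
    (hM : ∃ M : Mean S, M.RightInvariant) :
    ∃ c : Con S, (∀ a b : S, c a b ↔ ∃ x : S, x * a = x * b) ∧
      (∀ a b x : c.Quotient, a * x = b * x → a = b) ∧
      (∀ a b x : c.Quotient, x * a = x * b → a = b) ∧
      ∃ (G : Type u) (_ : Group G) (f : c.Quotient →ₙ* G),
        Function.Injective f := by
  obtain ⟨M, hM⟩ := hM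
  obtain ⟨G, _, f, hf⟩ := exists_mulHom_group_eq_iff hrc hM.exists_mul_eq_mul
  let g : (Con.ker f).Quotient →ₙ* G :=
    { toFun := Quotient.lift f fun _ _ => id
      map_mul' := by
        rintro ⟨a⟩ ⟨b⟩
        exact map_mul f a b }
  have hg : Function.Injective g := by
    rintro ⟨a⟩ ⟨b⟩ hab
    exact Quotient.sound hab
  refine ⟨Con.ker f, hf, fun a b x h => hg ?_, fun a b x h => hg ?_, G, _, g, hg⟩
  · exact mul_right_cancel (b := g x) (by rw [← map_mul, h, map_mul])
  · exact mul_left_cancel (a := g x) (by rw [← map_mul, h, map_mul])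
end
end

section
/- Let S be a semigroup of polynomials over ℂ under composition in which every element has degree at least 2, and suppose every pair of elements of S shares a common iterate. Then composition in S is left-cancellative: if A, X, Y ∈ S satisfy A∘X = A∘Y, then X = Y. Consequently S is a cancellative semigroup. -/
open Polynomial

noncomputable section

/-- The `n`-fold composition iterate of a polynomial (`polyIter P 0 = X`,
`polyIter P 1 = P`, ...). -/
def polyIter (P : ℂ[X]) : ℕ → ℂ[X]
  | 0 => X
  | n + 1 => P.comp (polyIter P n)

/-- The forward orbit `O_P(z) = {P^∘n(z) : n ≥ 0}` of `z` under `P`. -/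
def fwdOrbit (P : ℂ[X]) (z : ℂ) : Set ℂ :=
  Set.range fun n : ℕ => (polyIter P n).eval z

/-- A polynomial is exceptional if it has degree ≤ 1 or is affinely conjugate
(via `ℓ(z) = a z + b`, `a ≠ 0`) to a power map `z ↦ z^n` or to a Chebyshev
polynomial `Tₙ`; the conjugacy `ℓ⁻¹ ∘ P ∘ ℓ = Q` is expressed as `P ∘ ℓ = ℓ ∘ Q`. -/
def IsExceptional (P : ℂ[X]) : Prop :=
  P.degree ≤ 1 ∨
    ∃ a b : ℂ, a ≠ 0 ∧
      ((∃ n : ℕ, P.comp (C a * X + C b) = (C a * X + C b).comp (X ^ n)) ∨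
       (∃ n : ℕ, P.comp (C a * X + C b) = (C a * X + C b).comp (Chebyshev.T ℂ n)))

/-- Membership in the semigroup generated by a family `F` of polynomials
under composition. -/
inductive InGen (F : Set ℂ[X]) : ℂ[X] → Prop
  | base {P : ℂ[X]} : P ∈ F → InGen F P
  | comp {P Q : ℂ[X]} : InGen F P → InGen F Q → InGen F (P.comp Q)

theorem polyIter_add (P : ℂ[X]) (m n : ℕ) :
    polyIter P (m + n) = (polyIter P m).comp (polyIter P n) := by
  induction m with
  | zero => simp [polyIter]
  | succ m ih => rw [Nat.succ_add, polyIter, polyIter, ih, comp_assoc]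

theorem polyIter_one (P : ℂ[X]) : polyIter P 1 = P := by
  simp [polyIter]

theorem polyIter_comp_self (P : ℂ[X]) (n : ℕ) :
    (polyIter P n).comp P = P.comp (polyIter P n) := by
  have h := polyIter_add P n 1
  rw [polyIter_one] at h
  rw [← h, polyIter]

theorem polyIter_mul (P : ℂ[X]) (m n : ℕ) :
    polyIter P (m * n) = polyIter (polyIter P m) n := by
  induction n with
  | zero => rfl
  | succ n ih => rw [Nat.mul_succ, Nat.add_comm, polyIter_add, ih, polyIter]

theorem natDegree_polyIter (P : ℂ[X]) (n : ℕ) :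
    (polyIter P n).natDegree = P.natDegree ^ n := by
  induction n with
  | zero => simp [polyIter]
  | succ n ih => rw [polyIter, natDegree_comp, ih, pow_succ']

theorem comp_right_cancel {P Q R : ℂ[X]} (hR : R.natDegree ≠ 0)
    (h : P.comp R = Q.comp R) : P = Q := by
  have h0 : (P - Q).comp R = 0 := by rw [sub_comp, h, sub_self]
  rcases comp_eq_zero_iff.mp h0 with h1 | ⟨-, h1⟩
  · exact sub_eq_zero.mp h1
  · exact absurd (by rw [h1, natDegree_C]) hR

theorem polyIter_comp_congr {A P Q : ℂ[X]} (h : A.comp P = A.comp Q) {n : ℕ} (hn : 1 ≤ n) :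
    (polyIter A n).comp P = (polyIter A n).comp Q := by
  obtain ⟨k, rfl⟩ := Nat.exists_eq_add_of_le' hn
  rw [polyIter_add, polyIter_one, comp_assoc, comp_assoc, h]

/-- A semigroup of polynomials of degree at least 2 (under composition) in
which every pair shares a common iterate is left-cancellative, hence
cancellative. -/
theorem aip_implies_cancellative (S : Set ℂ[X])
    (hclosed : ∀ P ∈ S, ∀ Q ∈ S, P.comp Q ∈ S)
    (hdeg : ∀ P ∈ S, 2 ≤ P.natDegree)
    (haip : ∀ P ∈ S, ∀ Q ∈ S,
      ∃ m n : ℕ, 1 ≤ m ∧ 1 ≤ n ∧ polyIter P m = polyIter Q n) :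
    (∀ A ∈ S, ∀ X' ∈ S, ∀ Y ∈ S, A.comp X' = A.comp Y → X' = Y) ∧
      (∀ A ∈ S, ∀ X' ∈ S, ∀ Y ∈ S, X'.comp A = Y.comp A → X' = Y) := by
  have hpos : ∀ P ∈ S, P.natDegree ≠ 0 := fun P hP => by have := hdeg P hP; omega
  refine ⟨fun A hA P hP Q hQ h => ?_, fun A hA P _ Q _ h => comp_right_cancel (hpos A hA) h⟩
  obtain ⟨k, l, hk, -, hAP⟩ := haip A hA P hP
  obtain ⟨m, n, hm, -, hPQ⟩ := haip P hP Q hQ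
  -- A common iterate of `A`, `P` and `Q` commutes with both `P` and `Q`.
  have hGP : polyIter A (k * m) = polyIter P (l * m) := by
    rw [polyIter_mul, hAP, ← polyIter_mul]
  have hGQ : polyIter A (k * m) = polyIter Q (n * l) := by
    rw [hGP, Nat.mul_comm, polyIter_mul, hPQ, ← polyIter_mul]
  have hG := polyIter_comp_congr h (Nat.mul_pos hk hm)
  refine comp_right_cancel (R := polyIter A (k * m)) ?_ ?_
  · rw [natDegree_polyIter]
    exact pow_ne_zero _ (hpos A hA)
  · calc P.comp (polyIter A (k * m)) = (polyIter A (k * m)).comp P := by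
          rw [hGP, polyIter_comp_self]
      _ = (polyIter A (k * m)).comp Q := hG
      _ = Q.comp (polyIter A (k * m)) := by rw [hGQ, polyIter_comp_self]
end
end
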